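/- arXiv:2508.05948 — 3 statements merged into one kernel-verified Lean document; each statement's English description precedes it below -/
import Mathlib

section
/- Let A, B_1, …, B_k, E, F_1, …, F_k ∈ ℂ^{m×n}, let λ_1, …, λ_k ∈ ℂ, and let x ∈ ℂ^n be a unit vector such that (A + E) x = Σ_{s=1}^k λ_s (B_s + F_s) x. Then ‖A x − Σ_{s=1}^k λ_s B_s x‖₂² ≤ (1 + Σ_{s=1}^k |λ_s|²) (‖E‖_F² + Σ_{s=1}^k ‖F_s‖_F²). -/
open scoped BigOperators
open Matrix

noncomputable section

/-- Squared Frobenius norm of a complex matrix. -/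
def frobSq {α β : Type} [Fintype α] [Fintype β] (M : Matrix α β ℂ) : ℝ :=
  ∑ i, ∑ j, ‖M i j‖ ^ 2

/-- Squared Euclidean norm of a complex vector. -/
def vecNormSq {α : Type} [Fintype α] (x : α → ℂ) : ℝ :=
  ∑ i, ‖x i‖ ^ 2

/-- The Cauchy–Schwarz inequality for the bilinear dot product. -/
lemma norm_sum_mul_sq_le {ι : Type} [Fintype ι] (a b : ι → ℂ) :
    ‖∑ i, a i * b i‖ ^ 2 ≤ vecNormSq a * vecNormSq b :=
  calc ‖∑ i, a i * b i‖ ^ 2 ≤ (∑ i, ‖a i‖ * ‖b i‖) ^ 2 := by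
        gcongr
        exact (norm_sum_le _ _).trans_eq (by simp)
    _ ≤ vecNormSq a * vecNormSq b := Finset.sum_mul_sq_le_sq_mul_sq _ _ _

lemma vecNormSq_mulVec_le {α β : Type} [Fintype α] [Fintype β]
    (M : Matrix α β ℂ) (x : β → ℂ) :
    vecNormSq (M.mulVec x) ≤ frobSq M * vecNormSq x := by
  unfold frobSq
  rw [Finset.sum_mul]
  exact Finset.sum_le_sum fun i _ => norm_sum_mul_sq_le (M i) x

lemma vecNormSq_sum_smul_le {ι α : Type} [Fintype ι] [Fintype α]
    (c : ι → ℂ) (y : ι → α → ℂ) :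
    vecNormSq (∑ s, c s • y s) ≤ vecNormSq c * ∑ s, vecNormSq (y s) := by
  unfold vecNormSq
  rw [Finset.sum_comm, Finset.mul_sum]
  refine Finset.sum_le_sum fun i _ => ?_
  simpa [vecNormSq] using norm_sum_mul_sq_le c fun s => y s i

/-- If `(A + E) x = ∑ s λ s (B s + F s) x` for a unit vector `x`, then
`‖A x − ∑ s λ s B s x‖² ≤ (1 + ∑ s |λ s|²)(‖E‖_F² + ∑ s ‖F s‖_F²)`. -/
theorem stmt2 (m n k : ℕ)
    (A E : Matrix (Fin m) (Fin n) ℂ)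
    (B F : Fin k → Matrix (Fin m) (Fin n) ℂ)
    (lam : Fin k → ℂ) (x : Fin n → ℂ) (hx : vecNormSq x = 1)
    (h : (A + E).mulVec x = ∑ s, lam s • ((B s + F s).mulVec x)) :
    vecNormSq (A.mulVec x - ∑ s, lam s • (B s).mulVec x) ≤
      (1 + ∑ s, ‖lam s‖ ^ 2) * (frobSq E + ∑ s, frobSq (F s)) := by
  have mulVec_le (M : Matrix (Fin m) (Fin n) ℂ) : vecNormSq (M.mulVec x) ≤ frobSq M := by
    simpa [hx] using vecNormSq_mulVec_le M x
  have residual : A.mulVec x - ∑ s, lam s • (B s).mulVec x =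
      (-1 : ℂ) • E.mulVec x + ∑ s, lam s • (F s).mulVec x := by
    simp only [add_mulVec, smul_add, Finset.sum_add_distrib] at h
    rw [neg_one_smul, eq_sub_of_add_eq h]
    abel
  have bound := vecNormSq_sum_smul_le (fun s : Option (Fin k) => s.elim (-1) lam)
    (fun s => s.elim (E.mulVec x) fun t => (F t).mulVec x)
  rw [Fintype.sum_option, Fintype.sum_option] at bound
  have coeff : vecNormSq (fun s : Option (Fin k) => s.elim (-1) lam) =
      1 + ∑ s, ‖lam s‖ ^ 2 := by
    simp [vecNormSq, Fintype.sum_option]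
  rw [coeff] at bound
  rw [residual]
  refine bound.trans ?_
  gcongr
  · exact mulVec_le E
  · exact mulVec_le (F _)

end
end

section
/- Let A, B_1, …, B_k ∈ ℂ^{m×n}, let λ_1, …, λ_k ∈ ℂ, and let x ∈ ℂ^n be a unit vector. Set f = A x − Σ_{s=1}^k λ_s B_s x and τ² = 1 + Σ_{s=1}^k |λ_s|². Then the rank-one matrices E = −(1/τ²) f xᴴ and F_s = (conj(λ_s)/τ²) f xᴴ (1 ≤ s ≤ k) satisfy (A + E) x = Σ_{s=1}^k λ_s (B_s + F_s) x and ‖E‖_F² + Σ_{s=1}^k ‖F_s‖_F² = ‖f‖₂² / τ²; in particular, the lower bound ‖A x − Σ_{s=1}^k λ_s B_s x‖₂² / (1 + Σ_{s=1}^k |λ_s|²) on the perturbation size is attained. -/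
open scoped BigOperators
open Matrix

noncomputable section

theorem vecNormSq_star {α : Type} [Fintype α] (x : α → ℂ) :
    vecNormSq (star x) = vecNormSq x := by
  simp [vecNormSq]

theorem star_dotProduct_self_eq_vecNormSq {α : Type} [Fintype α] (x : α → ℂ) :
    star x ⬝ᵥ x = (vecNormSq x : ℂ) := by
  simp [dotProduct, vecNormSq, Complex.conj_mul']

theorem frobSq_smul_vecMulVec {α β : Type} [Fintype α] [Fintype β]
    (c : ℂ) (f : α → ℂ) (y : β → ℂ) :
    frobSq (c • vecMulVec f y) = ‖c‖ ^ 2 * (vecNormSq f * vecNormSq y) := by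
  rw [vecNormSq, vecNormSq, Finset.sum_mul_sum]
  simp only [frobSq, Finset.mul_sum, Matrix.smul_apply, vecMulVec_apply, smul_eq_mul, norm_mul,
    mul_pow]

theorem smul_vecMulVec_star_mulVec {α β : Type} [Fintype β]
    (c : ℂ) (f : α → ℂ) {x : β → ℂ} (hx : vecNormSq x = 1) :
    (c • vecMulVec f (star x)) *ᵥ x = c • f := by
  rw [smul_mulVec, vecMulVec_mulVec, star_dotProduct_self_eq_vecNormSq, hx]
  simp

/-- The explicit rank-one perturbations `E = −(1/τ²) f xᴴ`,
`F s = (conj (λ s)/τ²) f xᴴ` satisfy the perturbed eigen-equation and their total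
squared Frobenius norm is `‖f‖²/τ²`, so the lower bound
`‖A x − ∑ s λ s B s x‖²/(1 + ∑ s |λ s|²)` on the perturbation size is attained. -/
theorem stmt3 (m n k : ℕ)
    (A : Matrix (Fin m) (Fin n) ℂ)
    (B : Fin k → Matrix (Fin m) (Fin n) ℂ)
    (lam : Fin k → ℂ) (x : Fin n → ℂ) (hx : vecNormSq x = 1)
    (f : Fin m → ℂ) (hf : f = A.mulVec x - ∑ s, lam s • (B s).mulVec x)
    (τsq : ℝ) (hτ : τsq = 1 + ∑ s, ‖lam s‖ ^ 2)
    (E : Matrix (Fin m) (Fin n) ℂ)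
    (hE : E = (-(1 / (τsq : ℂ))) • Matrix.vecMulVec f (star x))
    (F : Fin k → Matrix (Fin m) (Fin n) ℂ)
    (hF : ∀ s, F s = ((starRingEnd ℂ) (lam s) / (τsq : ℂ)) • Matrix.vecMulVec f (star x)) :
    ((A + E).mulVec x = ∑ s, lam s • ((B s + F s).mulVec x)) ∧
    (frobSq E + ∑ s, frobSq (F s) = vecNormSq f / τsq) ∧
    (frobSq E + ∑ s, frobSq (F s) =
      vecNormSq (A.mulVec x - ∑ s, lam s • (B s).mulVec x) / (1 + ∑ s, ‖lam s‖ ^ 2)) := by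
  have hpos : 0 < τsq := by rw [hτ]; positivity
  have hne : (τsq : ℂ) ≠ 0 := by exact_mod_cast hpos.ne'
  have hsum : ∑ s, lam s * (starRingEnd ℂ) (lam s) = (τsq : ℂ) - 1 := by
    simp [hτ, Complex.mul_conj']
  have hnorm : frobSq E + ∑ s, frobSq (F s) = vecNormSq f / τsq := by
    have hlam : ∑ s, ‖lam s‖ ^ 2 = τsq - 1 := by rw [hτ]; ring
    simp only [hE, hF, frobSq_smul_vecMulVec, vecNormSq_star, hx, mul_one, norm_neg, norm_div,
      norm_one, RCLike.norm_conj, Complex.norm_real, Real.norm_of_nonneg hpos.le, div_pow,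
      ← Finset.sum_mul, ← Finset.sum_div, hlam]
    field_simp
    ring
  refine ⟨?_, hnorm, by rw [hnorm, hf, hτ]⟩
  have hcoef : ∑ s, lam s • ((starRingEnd ℂ) (lam s) / (τsq : ℂ)) • f =
      (((τsq : ℂ) - 1) / τsq) • f := by
    simp only [smul_smul, ← Finset.sum_smul, mul_div_assoc', ← Finset.sum_div, hsum]
  have hA : A *ᵥ x = f + ∑ s, lam s • B s *ᵥ x := by rw [hf]; abel
  simp only [add_mulVec, hE, hF, smul_vecMulVec_star_mulVec _ _ hx, smul_add,
    Finset.sum_add_distrib, hcoef, hA]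
  have hscal : (((τsq : ℂ) - 1) / τsq) • f = f + (-(1 / (τsq : ℂ))) • f := by
    rw [sub_div, div_self hne, sub_smul, one_smul, neg_smul, sub_eq_add_neg]
  rw [hscal]
  abel

end
end

section
/- Let k ≥ 1 and let A_i, B_{i1}, …, B_{ik} ∈ ℂ^{m_i×n_i} for 1 ≤ i ≤ k, and set m̃_i = min(m_i, (k+1)n_i). Then φ = Σ_{i=1}^k Σ_{j=n_i+1}^{m̃_i} σ_j([A_i, B_{i1}, …, B_{ik}])², where φ is the infimum of the constrained perturbation problem defined in the context. -/
open scoped BigOperators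
open Matrix

noncomputable section

/-- Horizontal concatenation `[A, B 0, B 1, …, B (k-1)]`; the column `(s, j)`
corresponds to column `s*n + j` (so columns of `A` come first). -/
def hcat {m n k : ℕ} (A : Matrix (Fin m) (Fin n) ℂ)
    (B : Fin k → Matrix (Fin m) (Fin n) ℂ) :
    Matrix (Fin m) (Fin (k + 1) × Fin n) ℂ :=
  Matrix.of fun i p => Fin.cases (A i p.2) (fun s => B s i p.2) p.1

/-- The rectangular "diagonal" matrix of an SVD of `[A, B 1, …, B k]`. -/
def svdSigma (m n k : ℕ) (σ : Fin (min m ((k + 1) * n)) → ℝ) :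
    Matrix (Fin (min m ((k + 1) * n))) (Fin (k + 1) × Fin n) ℂ :=
  Matrix.of fun i p =>
    if (i : ℕ) = (p.1 : ℕ) * n + (p.2 : ℕ) then ((σ i : ℝ) : ℂ) else 0

section Frobenius

variable {α β γ : Type} [Fintype α] [Fintype β] [Fintype γ]

theorem frobSq_nonneg (M : Matrix α β ℂ) : 0 ≤ frobSq M :=
  Finset.sum_nonneg fun _ _ => Finset.sum_nonneg fun _ _ => by positivity

theorem frobSq_conjTranspose (M : Matrix α β ℂ) : frobSq Mᴴ = frobSq M := by
  simp only [frobSq, conjTranspose_apply, norm_star]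
  exact Finset.sum_comm

theorem frobSq_eq_trace (M : Matrix α β ℂ) : frobSq M = (Mᴴ * M).trace.re := by
  simp only [frobSq, trace, diag, mul_apply, conjTranspose_apply, Complex.re_sum]
  rw [Finset.sum_comm]
  refine Finset.sum_congr rfl fun j _ => Finset.sum_congr rfl fun i _ => ?_
  rw [Complex.star_def, ← Complex.normSq_eq_conj_mul_self, Complex.ofReal_re,
    Complex.normSq_eq_norm_sq]

theorem frobSq_isometry_mul [DecidableEq β] {U : Matrix α β ℂ} (hU : Uᴴ * U = 1)
    (M : Matrix β γ ℂ) : frobSq (U * M) = frobSq M := by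
  rw [frobSq_eq_trace, frobSq_eq_trace, conjTranspose_mul, Matrix.mul_assoc,
    ← Matrix.mul_assoc Uᴴ, hU, Matrix.one_mul]

theorem frobSq_mul_coisometry [DecidableEq β] {V : Matrix β γ ℂ} (hV : V * Vᴴ = 1)
    (M : Matrix α β ℂ) : frobSq (M * V) = frobSq M := by
  rw [← frobSq_conjTranspose (M * V), conjTranspose_mul, frobSq_isometry_mul,
    frobSq_conjTranspose]
  rwa [conjTranspose_conjTranspose]

theorem frobSq_eq_add_of_isometry [DecidableEq β] [DecidableEq γ] {Z : Matrix β γ ℂ}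
    (hZ : Zᴴ * Z = 1) (M : Matrix α β ℂ) :
    frobSq M = frobSq (M * Z) + frobSq (M * (1 - Z * Zᴴ)) := by
  have hP : (1 - Z * Zᴴ) * (1 - Z * Zᴴ)ᴴ = 1 - Z * Zᴴ := by
    have h : Z * Zᴴ * (Z * Zᴴ) = Z * Zᴴ := by
      rw [Matrix.mul_assoc, ← Matrix.mul_assoc Zᴴ, hZ, Matrix.one_mul]
    simp only [conjTranspose_sub, conjTranspose_one, conjTranspose_mul,
      conjTranspose_conjTranspose, Matrix.sub_mul, Matrix.mul_sub, Matrix.one_mul,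
      Matrix.mul_one, h]
    abel
  have key (X : Matrix α β ℂ) : frobSq X = (X * Xᴴ).trace.re := by
    rw [← frobSq_conjTranspose, frobSq_eq_trace, conjTranspose_conjTranspose]
  rw [← frobSq_conjTranspose (M * Z), ← frobSq_conjTranspose (M * (1 - Z * Zᴴ)), key M,
    frobSq_eq_trace, frobSq_eq_trace, conjTranspose_conjTranspose, conjTranspose_conjTranspose,
    conjTranspose_mul M (1 - Z * Zᴴ), conjTranspose_mul M Z, Matrix.mul_assoc M (1 - Z * Zᴴ),
    ← Matrix.mul_assoc (1 - Z * Zᴴ), hP, ← Complex.add_re, ← trace_add]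
  congr 2
  simp only [Matrix.sub_mul, Matrix.mul_sub, Matrix.one_mul, Matrix.mul_assoc]
  abel

theorem frobSq_mul_isometry_le [DecidableEq β] [DecidableEq γ] {Z : Matrix β γ ℂ}
    (hZ : Zᴴ * Z = 1) (M : Matrix α β ℂ) : frobSq (M * Z) ≤ frobSq M := by
  rw [frobSq_eq_add_of_isometry hZ M]
  linarith [frobSq_nonneg (M * (1 - Z * Zᴴ))]

theorem row_normSq_le_one_of_isometry [DecidableEq β] [DecidableEq γ] {Z : Matrix β γ ℂ}
    (hZ : Zᴴ * Z = 1) (p : β) : ∑ j, ‖Z p j‖ ^ 2 ≤ 1 := by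
  have h := frobSq_mul_isometry_le hZ (Matrix.of fun (_ : Unit) q => if q = p then (1 : ℂ) else 0)
  simpa [frobSq, mul_apply, apply_ite] using h

theorem frobSq_of_isometry [DecidableEq γ] {Z : Matrix β γ ℂ} (hZ : Zᴴ * Z = 1) :
    frobSq Z = Fintype.card γ := by
  rw [frobSq_eq_trace, hZ, trace_one]
  simp

theorem exists_isometry_ker [DecidableEq β] (N : Matrix α β ℂ) :
    ∃ (r : ℕ) (Z : Matrix β (Fin r) ℂ), Zᴴ * Z = 1 ∧ N * Z = 0 ∧
      r + N.rank = Fintype.card β := by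
  classical
  let T := Matrix.toEuclideanLin N
  let b := stdOrthonormalBasis ℂ (LinearMap.ker T)
  refine ⟨_, Matrix.of fun p j => (b j : EuclideanSpace ℂ β) p, ?_, ?_, ?_⟩
  · ext i j
    have h := orthonormal_iff_ite.mp b.orthonormal i j
    rw [Submodule.coe_inner, PiLp.inner_apply] at h
    simp only [mul_apply, conjTranspose_apply, of_apply, one_apply, ← h]
    refine Finset.sum_congr rfl fun p _ => ?_
    simp [mul_comm]
  · ext i j
    have h : T (b j : EuclideanSpace ℂ β) = 0 := (b j).2
    exact congrArg (fun v : EuclideanSpace ℂ α => v i) h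
  · have h := LinearMap.finrank_range_add_finrank_ker T
    have hr : N.rank = Module.finrank ℂ (LinearMap.range T) := by
      rw [Matrix.rank_eq_finrank_range_toLin N (EuclideanSpace.basisFun α ℂ).toBasis
        (EuclideanSpace.basisFun β ℂ).toBasis]
      rfl
    rw [finrank_euclideanSpace] at h
    omega

end Frobenius

/-- A sum against weights in `[0, 1]` of total mass at most `n` is at most the sum of the
`n` largest terms. -/
theorem sum_mul_weight_le {N n : ℕ} (s w : Fin N → ℝ) (hs0 : ∀ j, 0 ≤ s j)
    (hs : Antitone s) (hw0 : ∀ j, 0 ≤ w j) (hw1 : ∀ j, w j ≤ 1) (hw : ∑ j, w j ≤ n) :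
    ∑ j, s j * w j ≤ ∑ j : Fin N, if (j : ℕ) < n then s j else 0 := by
  rcases le_or_gt N n with h | h
  · refine Finset.sum_le_sum fun j _ => ?_
    rw [if_pos (j.2.trans_le h)]
    exact mul_le_of_le_one_right (hs0 j) (hw1 j)
  · have hcard : ∑ j : Fin N, (if (j : ℕ) < n then (1 : ℝ) else 0) = n := by
      rw [Fin.sum_univ_eq_sum_range (fun j => if j < n then (1 : ℝ) else 0) N,
        ← Finset.sum_filter]
      have : (Finset.range N).filter (· < n) = Finset.range n := by
        ext x; simp; omega
      simp [this]
    have hterm : 0 ≤ ∑ j : Fin N, (s j - s ⟨n, h⟩) * ((if (j : ℕ) < n then 1 else 0) - w j) := by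
      refine Finset.sum_nonneg fun j _ => ?_
      split_ifs with hj
      · exact mul_nonneg (sub_nonneg.2 (hs (Fin.le_def.2 hj.le))) (sub_nonneg.2 (hw1 j))
      · exact mul_nonneg_of_nonpos_of_nonpos
          (sub_nonpos.2 (hs (Fin.le_def.2 (not_lt.1 hj)))) (by linarith [hw0 j])
    have hexp : ∑ j : Fin N, (s j - s ⟨n, h⟩) * ((if (j : ℕ) < n then 1 else 0) - w j) =
        (∑ j : Fin N, if (j : ℕ) < n then s j else 0) - ∑ j, s j * w j
          - s ⟨n, h⟩ * (n - ∑ j, w j) := by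
      rw [← hcard, ← Finset.sum_sub_distrib, ← Finset.sum_sub_distrib, Finset.mul_sum,
        ← Finset.sum_sub_distrib]
      refine Finset.sum_congr rfl fun j _ => ?_
      split_ifs <;> ring
    have := mul_nonneg (hs0 ⟨n, h⟩) (sub_nonneg.2 hw)
    linarith

section SVD

variable {m n k : ℕ}

/-- The block column carrying the `j`-th diagonal entry of `svdSigma`. -/
def diagCol (m n k : ℕ) (j : Fin (min m ((k + 1) * n))) : Fin (k + 1) × Fin n :=
  finProdFinEquiv.symm (Fin.castLE (min_le_right _ _) j)

theorem diagCol_injective : Function.Injective (diagCol m n k) :=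
  finProdFinEquiv.symm.injective.comp (Fin.castLE_injective _)

theorem svdSigma_apply (σ : Fin (min m ((k + 1) * n)) → ℝ) (j : Fin (min m ((k + 1) * n)))
    (p : Fin (k + 1) × Fin n) :
    svdSigma m n k σ j p = if p = diagCol m n k j then (σ j : ℂ) else 0 := by
  have h : ((j : ℕ) = (p.1 : ℕ) * n + (p.2 : ℕ)) ↔ p = diagCol m n k j := by
    rw [diagCol, Equiv.eq_symm_apply, Fin.ext_iff]
    simp only [finProdFinEquiv_apply_val, Fin.val_castLE]
    rw [mul_comm n, add_comm (p.2 : ℕ)]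
    exact eq_comm
  simp only [svdSigma, of_apply, h]

theorem diagCol_fst_eq_zero_iff (j : Fin (min m ((k + 1) * n))) :
    (diagCol m n k j).1 = 0 ↔ (j : ℕ) < n := by
  have hn : 0 < n := (diagCol m n k j).2.pos
  have h : ((diagCol m n k j).1 : ℕ) = (j : ℕ) / n := by
    simp [diagCol, finProdFinEquiv]
  rw [Fin.ext_iff, h, Fin.val_zero, Nat.div_eq_zero_iff]
  omega

/-- Eckart–Young lower bound: the tail of the squared singular values bounds the squared
Frobenius distance to matrices of rank at most `n`. -/
theorem tail_le_frobSq_sub {M N : Matrix (Fin m) (Fin (k + 1) × Fin n) ℂ}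
    {U : Matrix (Fin m) (Fin (min m ((k + 1) * n))) ℂ}
    {σ : Fin (min m ((k + 1) * n)) → ℝ}
    {V : Matrix (Fin (k + 1) × Fin n) (Fin (k + 1) × Fin n) ℂ}
    (hU : Uᴴ * U = 1) (hV : Vᴴ * V = 1)
    (hσ0 : ∀ j, 0 ≤ σ j) (hσm : Antitone σ)
    (hM : M = U * svdSigma m n k σ * Vᴴ) (hN : N.rank ≤ n) :
    (∑ j : Fin (min m ((k + 1) * n)), if n ≤ (j : ℕ) then σ j ^ 2 else 0) ≤
      frobSq (N - M) := by
  obtain ⟨r, Z, hZ, hNZ, hr⟩ := exists_isometry_ker (N * V)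
  have hrank : (N * V).rank ≤ n := (rank_mul_le_left N V).trans hN
  have hVV : V * Vᴴ = 1 := mul_eq_one_comm.1 hV
  have hMV : M * V = U * svdSigma m n k σ := by
    rw [hM, Matrix.mul_assoc, hV, Matrix.mul_one]
  have hlow : frobSq (svdSigma m n k σ * Z) ≤ frobSq (N - M) := by
    rw [← frobSq_mul_coisometry hVV (N - M)]
    refine le_trans (le_of_eq ?_) (frobSq_mul_isometry_le hZ _)
    rw [Matrix.sub_mul, Matrix.sub_mul, hNZ, hMV, zero_sub, Matrix.mul_assoc,
      ← Matrix.mul_neg, frobSq_isometry_mul hU]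
    simp [frobSq]
  refine le_trans ?_ hlow
  let w : Fin (k + 1) × Fin n → ℝ := fun p => 1 - ∑ j, ‖Z p j‖ ^ 2
  have hw0 (p) : 0 ≤ w p := sub_nonneg.2 (row_normSq_le_one_of_isometry hZ p)
  have hw1 (p) : w p ≤ 1 := sub_le_self _ (Finset.sum_nonneg fun _ _ => by positivity)
  have hwsum : ∑ p, w p ≤ n := by
    have h1 : ∑ p, w p = Fintype.card (Fin (k + 1) × Fin n) - frobSq Z := by
      simp [w, frobSq, Finset.sum_sub_distrib]
    rw [h1, frobSq_of_isometry hZ, ← hr, Fintype.card_fin]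
    push_cast
    have : ((N * V).rank : ℝ) ≤ n := by exact_mod_cast hrank
    linarith
  have hwj : ∑ j, w (diagCol m n k j) ≤ n := by
    rw [← Finset.sum_image (f := w) (fun a _ b _ h => diagCol_injective h)]
    exact (Finset.sum_le_univ_sum_of_nonneg hw0).trans hwsum
  have hcomb := sum_mul_weight_le (fun j => σ j ^ 2) (fun j => w (diagCol m n k j))
    (fun j => by positivity) (fun i j h => pow_le_pow_left₀ (hσ0 j) (hσm h) 2)
    (fun j => hw0 _) (fun j => hw1 _) hwj
  have hfro : frobSq (svdSigma m n k σ * Z) =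
      ∑ j, (σ j ^ 2 - σ j ^ 2 * w (diagCol m n k j)) := by
    refine Finset.sum_congr rfl fun j _ => ?_
    simp only [mul_apply, svdSigma_apply, ite_mul, zero_mul, Finset.sum_ite_eq',
      Finset.mem_univ, if_true, norm_mul, mul_pow, w,
      Complex.norm_real, Real.norm_eq_abs, sq_abs]
    rw [← Finset.mul_sum]
    ring
  have hsplit : (∑ j : Fin (min m ((k + 1) * n)), if n ≤ (j : ℕ) then σ j ^ 2 else 0) =
      ∑ j, σ j ^ 2 - ∑ j : Fin (min m ((k + 1) * n)), if (j : ℕ) < n then σ j ^ 2 else 0 := by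
    rw [← Finset.sum_sub_distrib]
    refine Finset.sum_congr rfl fun j _ => ?_
    by_cases h : n ≤ (j : ℕ)
    · simp [h, not_lt.2 h]
    · simp [h, not_le.1 h]
  rw [hfro, Finset.sum_sub_distrib, hsplit]
  linarith

/-- The leading `n` left columns and right rows of a singular value decomposition give a
rank-`n` factorization attaining the tail of the squared singular values. -/
theorem frobSq_truncation_sub {M : Matrix (Fin m) (Fin (k + 1) × Fin n) ℂ}
    {U : Matrix (Fin m) (Fin (min m ((k + 1) * n))) ℂ}
    {σ : Fin (min m ((k + 1) * n)) → ℝ}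
    {V : Matrix (Fin (k + 1) × Fin n) (Fin (k + 1) × Fin n) ℂ}
    (hU : Uᴴ * U = 1) (hV : Vᴴ * V = 1)
    (hM : M = U * svdSigma m n k σ * Vᴴ) :
    frobSq ((U * svdSigma m n k σ).submatrix id (fun l : Fin n => ((0 : Fin (k + 1)), l)) *
        Vᴴ.submatrix (fun l : Fin n => ((0 : Fin (k + 1)), l)) id - M) =
      ∑ j : Fin (min m ((k + 1) * n)), if n ≤ (j : ℕ) then σ j ^ 2 else 0 := by
  let S : Matrix (Fin (min m ((k + 1) * n))) (Fin (k + 1) × Fin n) ℂ :=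
    Matrix.of fun j p => if p.1 = 0 then 0 else svdSigma m n k σ j p
  have hdiff : (U * svdSigma m n k σ).submatrix id (fun l : Fin n => ((0 : Fin (k + 1)), l)) *
        Vᴴ.submatrix (fun l : Fin n => ((0 : Fin (k + 1)), l)) id - M = -(U * S * Vᴴ) := by
    have hUS (i) (p : Fin (k + 1) × Fin n) :
        (U * S) i p = if p.1 = 0 then 0 else (U * svdSigma m n k σ) i p := by
      by_cases hp : p.1 = 0 <;> simp [mul_apply, S, hp]
    ext i q
    rw [hM, Matrix.sub_apply, Matrix.neg_apply, mul_apply,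
      mul_apply (M := U * svdSigma m n k σ), mul_apply (M := U * S),
      Fintype.sum_prod_type, Fintype.sum_prod_type, Fin.sum_univ_succ, Fin.sum_univ_succ]
    simp only [hUS, submatrix_apply, id]
    simp [Fin.succ_ne_zero]
  have hneg (X : Matrix (Fin m) (Fin (k + 1) × Fin n) ℂ) : frobSq (-X) = frobSq X := by
    simp [frobSq]
  rw [hdiff, hneg, frobSq_mul_coisometry (by rwa [conjTranspose_conjTranspose]),
    frobSq_isometry_mul hU]
  refine Finset.sum_congr rfl fun j _ => ?_
  rw [Finset.sum_eq_single (diagCol m n k j)]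
  · simp only [S, of_apply, diagCol_fst_eq_zero_iff, svdSigma_apply, if_true]
    by_cases h : n ≤ (j : ℕ)
    · simp [h, not_lt.2 h]
    · simp [h, not_le.1 h]
  · intro p _ hp
    simp [S, svdSigma_apply, hp]
  · simp

end SVD

theorem hcat_sub {m n k : ℕ} (A A' : Matrix (Fin m) (Fin n) ℂ)
    (B B' : Fin k → Matrix (Fin m) (Fin n) ℂ) :
    hcat (A - A') (fun s => B s - B' s) = hcat A B - hcat A' B' := by
  ext i ⟨s, j⟩
  refine Fin.cases ?_ (fun s => ?_) s <;> simp [hcat]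

theorem hcat_submatrix {m n k : ℕ} (N : Matrix (Fin m) (Fin (k + 1) × Fin n) ℂ) :
    hcat (N.submatrix id (Prod.mk 0)) (fun s => N.submatrix id (Prod.mk s.succ)) = N := by
  ext i ⟨s, j⟩
  refine Fin.cases ?_ (fun s => ?_) s <;> simp [hcat]

theorem eventually_isUnit_det_add_smul_one {n : ℕ} (Q : Matrix (Fin n) (Fin n) ℂ) :
    ∀ᶠ ε : ℂ in nhdsWithin 0 {0}ᶜ, IsUnit (Q + ε • (1 : Matrix (Fin n) (Fin n) ℂ)).det := by
  have hfin : {ε : ℂ | (-Q).charpoly.IsRoot ε}.Finite :=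
    Polynomial.finite_setOfPred_isRoot (Matrix.charpoly_monic _).ne_zero
  have hmem : ({ε : ℂ | (-Q).charpoly.IsRoot ε} \ {0})ᶜ ∈ nhds (0 : ℂ) :=
    hfin.sdiff.isClosed.isOpen_compl.mem_nhds (by simp)
  filter_upwards [mem_nhdsWithin_of_mem_nhds hmem, self_mem_nhdsWithin] with ε h1 h2
  refine isUnit_iff_ne_zero.2 fun h => h1 ⟨?_, h2⟩
  rw [Set.mem_ofPred_eq, Polynomial.IsRoot, Matrix.eval_charpoly, ← h, sub_neg_eq_add, add_comm,
    Matrix.smul_one_eq_diagonal]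
  rfl

/-- A factored matrix `P * Q` whose block `Q s` is invertible satisfies the linear
constraint expressing its first block through the remaining ones. -/
theorem exists_first_block_eq_sum {m n k : ℕ} (P : Matrix (Fin m) (Fin n) ℂ)
    (Q : Matrix (Fin n) (Fin (k + 1) × Fin n) ℂ) (s : Fin k)
    (hQ : IsUnit (Q.submatrix id (Prod.mk s.succ)).det) :
    ∃ X : Fin k → Matrix (Fin n) (Fin n) ℂ,
      (P * Q).submatrix id (Prod.mk 0) =
        ∑ t, (P * Q).submatrix id (Prod.mk t.succ) * X t := by
  refine ⟨fun t => if t = s then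
    (Q.submatrix id (Prod.mk s.succ))⁻¹ * Q.submatrix id (Prod.mk 0) else 0, ?_⟩
  have hsub (t : Fin (k + 1)) :
      (P * Q).submatrix id (Prod.mk t) = P * Q.submatrix id (Prod.mk t) := rfl
  simp only [hsub]
  rw [Finset.sum_eq_single s (fun t _ ht => by rw [if_neg ht, Matrix.mul_zero]) (by simp),
    if_pos rfl, Matrix.mul_assoc, ← Matrix.mul_assoc (Q.submatrix id (Prod.mk s.succ)),
    Matrix.mul_nonsing_inv _ hQ, Matrix.one_mul]

/-- Theorem 5.4: `φ = ∑_{i=1}^k ∑_{j=n_i+1}^{m̃_i} σ_j([A_i, B_{i1}, …, B_{ik}])²`,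
where the singular values `σ i` are provided by SVDs
`[A_i, B_{i1}, …, B_{ik}] = Uⁱ Σⁱ (Vⁱ)ᴴ`. -/
theorem stmt8 (k : ℕ) (hk : 1 ≤ k) (m n : Fin k → ℕ)
    (A : ∀ i, Matrix (Fin (m i)) (Fin (n i)) ℂ)
    (B : ∀ i, Fin k → Matrix (Fin (m i)) (Fin (n i)) ℂ)
    (U : ∀ i, Matrix (Fin (m i)) (Fin (min (m i) ((k + 1) * n i))) ℂ)
    (σ : ∀ i, Fin (min (m i) ((k + 1) * n i)) → ℝ)
    (V : ∀ i, Matrix (Fin (k + 1) × Fin (n i)) (Fin (k + 1) × Fin (n i)) ℂ)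
    (hU : ∀ i, (U i)ᴴ * U i = 1) (hV : ∀ i, (V i)ᴴ * V i = 1)
    (hσ0 : ∀ i j, 0 ≤ σ i j) (hσm : ∀ i j₁ j₂, j₁ ≤ j₂ → σ i j₂ ≤ σ i j₁)
    (hSVD : ∀ i, hcat (A i) (B i) = U i * svdSigma (m i) (n i) k (σ i) * (V i)ᴴ) :
    sInf {t : ℝ |
      ∃ (Ah : ∀ i, Matrix (Fin (m i)) (Fin (n i)) ℂ)
        (Bh : ∀ i, Fin k → Matrix (Fin (m i)) (Fin (n i)) ℂ)
        (X : ∀ i, Fin k → Matrix (Fin (n i)) (Fin (n i)) ℂ),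
        (∀ i, Ah i = ∑ s, Bh i s * X i s) ∧
        (∀ i, (hcat (Ah i) (Bh i)).rank ≤ n i) ∧
        t = ∑ i, frobSq (hcat (Ah i - A i) (fun s => Bh i s - B i s))} =
    ∑ i, ∑ j : Fin (min (m i) ((k + 1) * n i)),
      if n i ≤ (j : ℕ) then σ i j ^ 2 else 0 := by
  set F : ℝ := ∑ i, ∑ j : Fin (min (m i) ((k + 1) * n i)),
    if n i ≤ (j : ℕ) then σ i j ^ 2 else 0 with hF
  have hlow : F ∈ lowerBounds {t : ℝ |
      ∃ (Ah : ∀ i, Matrix (Fin (m i)) (Fin (n i)) ℂ)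
        (Bh : ∀ i, Fin k → Matrix (Fin (m i)) (Fin (n i)) ℂ)
        (X : ∀ i, Fin k → Matrix (Fin (n i)) (Fin (n i)) ℂ),
        (∀ i, Ah i = ∑ s, Bh i s * X i s) ∧
        (∀ i, (hcat (Ah i) (Bh i)).rank ≤ n i) ∧
        t = ∑ i, frobSq (hcat (Ah i - A i) (fun s => Bh i s - B i s))} := by
    rintro t ⟨Ah, Bh, X, -, hrank, rfl⟩
    refine Finset.sum_le_sum fun i _ => ?_
    rw [hcat_sub]
    exact tail_le_frobSq_sub (hU i) (hV i) (hσ0 i) (fun a b h => hσm i a b h) (hSVD i) (hrank i)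
  let P (i) : Matrix (Fin (m i)) (Fin (n i)) ℂ :=
    (U i * svdSigma (m i) (n i) k (σ i)).submatrix id (fun l : Fin (n i) => ((0 : Fin (k + 1)), l))
  let Q (i) : Matrix (Fin (n i)) (Fin (k + 1) × Fin (n i)) ℂ :=
    (V i)ᴴ.submatrix (fun l : Fin (n i) => ((0 : Fin (k + 1)), l)) id
  let s₀ : Fin k := ⟨0, hk⟩
  let E (i) : Matrix (Fin (n i)) (Fin (k + 1) × Fin (n i)) ℂ :=
    Matrix.of fun l p => if p = (s₀.succ, l) then 1 else 0
  let N (ε : ℂ) (i) : Matrix (Fin (m i)) (Fin (k + 1) × Fin (n i)) ℂ := P i * (Q i + ε • E i)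
  let cost (ε : ℂ) : ℝ := ∑ i, frobSq (N ε i - hcat (A i) (B i))
  have hcost : Continuous cost := by
    simp only [cost, N, frobSq, Matrix.sub_apply, mul_apply, Matrix.add_apply, Matrix.smul_apply]
    fun_prop
  have hcost0 : cost 0 = F := by
    refine Finset.sum_congr rfl fun i _ => ?_
    simp only [N, zero_smul, add_zero]
    exact frobSq_truncation_sub (hU i) (hV i) (hSVD i)
  have hlim : Filter.Tendsto cost (nhdsWithin 0 {0}ᶜ) (nhds F) :=
    hcost0 ▸ (hcost.tendsto 0).mono_left nhdsWithin_le_nhds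
  have hfeas : ∀ᶠ ε : ℂ in nhdsWithin 0 {0}ᶜ, cost ε ∈ {t : ℝ |
      ∃ (Ah : ∀ i, Matrix (Fin (m i)) (Fin (n i)) ℂ)
        (Bh : ∀ i, Fin k → Matrix (Fin (m i)) (Fin (n i)) ℂ)
        (X : ∀ i, Fin k → Matrix (Fin (n i)) (Fin (n i)) ℂ),
        (∀ i, Ah i = ∑ s, Bh i s * X i s) ∧
        (∀ i, (hcat (Ah i) (Bh i)).rank ≤ n i) ∧
        t = ∑ i, frobSq (hcat (Ah i - A i) (fun s => Bh i s - B i s))} := by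
    filter_upwards [Filter.eventually_all.2 fun i =>
      eventually_isUnit_det_add_smul_one ((Q i).submatrix id (Prod.mk s₀.succ))] with ε hε
    have hX (i) := exists_first_block_eq_sum (P i) (Q i + ε • E i) s₀ (by
      convert hε i using 2
      ext a b
      simp [E, Matrix.one_apply, eq_comm])
    choose X hX using hX
    refine ⟨fun i => (N ε i).submatrix id (Prod.mk 0),
      fun i s => (N ε i).submatrix id (Prod.mk s.succ), X, hX, fun i => ?_, ?_⟩
    · rw [hcat_submatrix]
      refine (rank_mul_le_left _ _).trans ((rank_le_card_width _).trans ?_)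
      simp
    · refine Finset.sum_congr rfl fun i _ => ?_
      rw [hcat_sub, hcat_submatrix]
  refine le_antisymm ?_ (le_csInf (hfeas.exists.imp' cost fun _ h => h) hlow)
  exact ge_of_tendsto hlim (hfeas.mono fun ε h => csInf_le ⟨F, hlow⟩ h)

end
end
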